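/- arXiv:0707.2347 — 13 statements merged into one kernel-verified Lean document; each statement's English description precedes it below -/
import Mathlib

section
/- Let R be a commutative ring, n ≥ 1, and let A11, A12, A21, A22, B11, B12, B21, B22 be n×n matrices over R. Define S1 = A21 + A22, S2 = S1 − A11, S3 = A11 − A21, S4 = A12 − S2, T1 = B12 − B11, T2 = B22 − T1, T3 = B22 − B12, T4 = T2 − B21, the seven products P1 = A11·B11, P2 = A12·B21, P3 = S4·B22, P4 = A22·T4, P5 = S1·T1, P6 = S2·T2, P7 = S3·T3, and U1 = P1 + P2, U2 = P1 + P6, U3 = U2 + P7, U4 = U2 + P5, U5 = U4 + P3, U6 = U3 − P4, U7 = U3 + P5. Then the 2n×2n block matrix [U1, U5; U6, U7] equals the product [A11, A12; A21, A22]·[B11, B12; B21, B22]. -/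
open Matrix

/-- Correctness of Strassen-Winograd's algorithm: the 22 block operations
compute the 2×2 block matrix product with 7 block multiplications. -/
theorem strassen_winograd_correct {R : Type*} [CommRing R] {n : ℕ} (hn : 1 ≤ n)
    (A11 A12 A21 A22 B11 B12 B21 B22 : Matrix (Fin n) (Fin n) R) :
    let S1 := A21 + A22
    let S2 := S1 - A11
    let S3 := A11 - A21
    let S4 := A12 - S2
    let T1 := B12 - B11
    let T2 := B22 - T1
    let T3 := B22 - B12
    let T4 := T2 - B21
    let P1 := A11 * B11
    let P2 := A12 * B21
    let P3 := S4 * B22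
    let P4 := A22 * T4
    let P5 := S1 * T1
    let P6 := S2 * T2
    let P7 := S3 * T3
    let U1 := P1 + P2
    let U2 := P1 + P6
    let U3 := U2 + P7
    let U4 := U2 + P5
    let U5 := U4 + P3
    let U6 := U3 - P4
    let U7 := U3 + P5
    fromBlocks U1 U5 U6 U7 =
      fromBlocks A11 A12 A21 A22 * fromBlocks B11 B12 B21 B22 := by
  dsimp only
  rw [fromBlocks_multiply, fromBlocks_inj]
  refine ⟨rfl, ?_, ?_, ?_⟩ <;> noncomm_ring
end

section
/- Let R be a commutative ring, n ≥ 1, α, β ∈ R, and let A = [A11, A12; A21, A22], B = [B11, B12; B21, B22], C = [C11, C12; C21, C22] be 2n×2n matrices over R partitioned into n×n blocks, with C11⁰, C12⁰, C21⁰, C22⁰ denoting the initial contents of the C blocks. Execute in order the assignments (each using the current contents of its operands): X ← A21+A22; Y ← B12−B11; Z ← α·X·Y; C22 ← Z + β·C22; C12 ← Z + β·C12; X ← X − A11; Y ← B22 − Y; Z ← α·A11·B11; C11 ← Z + β·C11; Z ← α·X·Y + Z; C11 ← α·A12·B21 + C11; X ← A12 − X; Y ← Y − B21; C12 ← α·X·B22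 + C12; C12 ← Z + C12; C21 ← α·A22·Y − β·C21; X ← A11 − A21; Y ← B22 − B12; Z ← α·X·Y + Z; C22 ← Z + C22; C21 ← Z − C21. Then the final 2n×2n matrix [C11, C12; C21, C22] equals α·A·B + β·C⁰, where C⁰ is the initial matrix C. -/
open Matrix

/-- Correctness of the Huss-Lederman et al. schedule (Table 2) for
`C ← α·A·B + β·C` with three temporaries X, Y, Z.  Each `let` re-binding
models an assignment overwriting a memory location, computed from the
current contents of its operand locations. -/
theorem huss_lederman_accumulation_correct {R : Type*} [CommRing R] {n : ℕ}
    (hn : 1 ≤ n) (α β : R)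
    (A11 A12 A21 A22 B11 B12 B21 B22 C11 C12 C21 C22 : Matrix (Fin n) (Fin n) R) :
    let X := A21 + A22
    let Y := B12 - B11
    let Z := α • (X * Y)
    let c22 := Z + β • C22
    let c12 := Z + β • C12
    let X := X - A11
    let Y := B22 - Y
    let Z := α • (A11 * B11)
    let c11 := Z + β • C11
    let Z := α • (X * Y) + Z
    let c11 := α • (A12 * B21) + c11
    let X := A12 - X
    let Y := Y - B21
    let c12 := α • (X * B22) + c12
    let c12 := Z + c12
    let c21 := α • (A22 * Y) - β • C21
    let X := A11 - A21
    let Y := B22 - B12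
    let Z := α • (X * Y) + Z
    let c22 := Z + c22
    let c21 := Z - c21
    fromBlocks c11 c12 c21 c22 =
      α • (fromBlocks A11 A12 A21 A22 * fromBlocks B11 B12 B21 B22) +
        β • fromBlocks C11 C12 C21 C22 := by
  simp only [fromBlocks_multiply, fromBlocks_smul, fromBlocks_add, fromBlocks_inj, add_mul,
    sub_mul, mul_sub, smul_add, smul_sub]
  refine ⟨?_, ?_, ?_, ?_⟩ <;> abel
end

section
/- Let R be a commutative ring, n ≥ 1, and let A = [A11, A12; A21, A22] and B = [B11, B12; B21, B22] be 2n×2n matrices over R partitioned into n×n blocks, with A⁰, B⁰ their initial values. Execute in order the assignments (each using the current contents of its operands): C11 ← A11 − A21; A21 ← A21 + A22; C22 ← B12 − B11; B12 ← B22 − B12; C21 ← C11·B12; C12 ← A21 − A11; C11 ← A11·B11; B11 ← B22 − C22; A11 ← A21·C22; C22 ← B11 − B21; A21 ← A22·C22; A22 ← A12 − C12; C22 ← C12·B11; C22 ← C11 + C22; C12 ← A12·B21; C11 ← C11 + C12; C12 ← C22 + A11; C22 ← C22 + C21; C21 ← C22 − A21; C22 ← C22 + A11; A12 ← A22·B22;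 C12 ← C12 + A12. Then the final 2n×2n matrix [C11, C12; C21, C22] equals A⁰·B⁰. -/
open Matrix

/-- Correctness of the fully in-place schedule IP (Table 3) for `C ← A·B`:
no temporary memory beyond the blocks of `C` is used, the blocks of `A` and
`B` being overwritten.  Each `let` re-binding models an assignment
overwriting a memory location, computed from the current contents of its
operand locations. -/
theorem inplace_IP_correct {R : Type*} [CommRing R] {n : ℕ} (hn : 1 ≤ n)
    (A11 A12 A21 A22 B11 B12 B21 B22 : Matrix (Fin n) (Fin n) R) :
    let a11 := A11
    let a12 := A12
    let a21 := A21
    let a22 := A22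
    let b11 := B11
    let b12 := B12
    let b21 := B21
    let b22 := B22
    let c11 := a11 - a21
    let a21 := a21 + a22
    let c22 := b12 - b11
    let b12 := b22 - b12
    let c21 := c11 * b12
    let c12 := a21 - a11
    let c11 := a11 * b11
    let b11 := b22 - c22
    let a11 := a21 * c22
    let c22 := b11 - b21
    let a21 := a22 * c22
    let a22 := a12 - c12
    let c22 := c12 * b11
    let c22 := c11 + c22
    let c12 := a12 * b21
    let c11 := c11 + c12
    let c12 := c22 + a11
    let c22 := c22 + c21
    let c21 := c22 - a21
    let c22 := c22 + a11
    let a12 := a22 * b22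
    let c12 := c12 + a12
    fromBlocks c11 c12 c21 c22 =
      fromBlocks A11 A12 A21 A22 * fromBlocks B11 B12 B21 B22 := by
  dsimp only
  rw [fromBlocks_multiply, fromBlocks_inj]
  refine ⟨?_, ?_, ?_, ?_⟩ <;> noncomm_ring
end

section
/- Let R be a commutative ring, n ≥ 1, and let A = [A11, A12; A21, A22] and B = [B11, B12; B21, B22] be 2n×2n matrices over R partitioned into n×n blocks, with A⁰, B⁰ their initial values. Execute in order the assignments (each using the current contents of its operands): C22 ← A11 − A21; A21 ← A21 + A22; C12 ← A21 − A11; C21 ← B12 − B11; C11 ← A11·B11; A11 ← B22 − B12; X ← C22·A11; A11 ← B22 − C21; C22 ← A21·C21; C21 ← A12 − C12; A21 ← C21·B22; C21 ← C12·A11; A11 ← A11 − B21; C21 ← C11 + C21; C12 ← C21 + C22; C21 ← C21 + X; C22 ← C21 + C22; C12 ← C12 + A21; X ← A12·B21; C11 ← C11 + X; A21 ← A22·A11; C21 ← C21 − A21. Then: (i) the final 2n×2n matrix [C11, C12; C21, C22] equals A⁰·B⁰; and (ii) the program never writes into A12, A22, or any block of B, so B and the blocks A12, A22 retain their initial values.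 -/
open Matrix

/-- The memory state of the schedule OvL: the blocks of `A`, `B`, `C` and
one temporary block `X`, all of dimension `n × n`. -/
structure OvLState (R : Type*) (n : ℕ) where
  a11 : Matrix (Fin n) (Fin n) R
  a12 : Matrix (Fin n) (Fin n) R
  a21 : Matrix (Fin n) (Fin n) R
  a22 : Matrix (Fin n) (Fin n) R
  b11 : Matrix (Fin n) (Fin n) R
  b12 : Matrix (Fin n) (Fin n) R
  b21 : Matrix (Fin n) (Fin n) R
  b22 : Matrix (Fin n) (Fin n) R
  c11 : Matrix (Fin n) (Fin n) R
  c12 : Matrix (Fin n) (Fin n) R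
  c21 : Matrix (Fin n) (Fin n) R
  c22 : Matrix (Fin n) (Fin n) R
  x : Matrix (Fin n) (Fin n) R

/-- The straight-line schedule OvL (Table 4) for `C ← A·B`, executed as a
sequence of in-place assignments, each computed from the current (possibly
overwritten) contents of its operand locations. -/
def ovlRun {R : Type*} [CommRing R] {n : ℕ} (s : OvLState R n) : OvLState R n :=
  let s : OvLState R n := { s with c22 := s.a11 - s.a21 }
  let s : OvLState R n := { s with a21 := s.a21 + s.a22 }
  let s : OvLState R n := { s with c12 := s.a21 - s.a11 }
  let s : OvLState R n := { s with c21 := s.b12 - s.b11 }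
  let s : OvLState R n := { s with c11 := s.a11 * s.b11 }
  let s : OvLState R n := { s with a11 := s.b22 - s.b12 }
  let s : OvLState R n := { s with x := s.c22 * s.a11 }
  let s : OvLState R n := { s with a11 := s.b22 - s.c21 }
  let s : OvLState R n := { s with c22 := s.a21 * s.c21 }
  let s : OvLState R n := { s with c21 := s.a12 - s.c12 }
  let s : OvLState R n := { s with a21 := s.c21 * s.b22 }
  let s : OvLState R n := { s with c21 := s.c12 * s.a11 }
  let s : OvLState R n := { s with a11 := s.a11 - s.b21 }
  let s : OvLState R n := { s with c21 := s.c11 + s.c21 }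
  let s : OvLState R n := { s with c12 := s.c21 + s.c22 }
  let s : OvLState R n := { s with c21 := s.c21 + s.x }
  let s : OvLState R n := { s with c22 := s.c21 + s.c22 }
  let s : OvLState R n := { s with c12 := s.c12 + s.a21 }
  let s : OvLState R n := { s with x := s.a12 * s.b21 }
  let s : OvLState R n := { s with c11 := s.c11 + s.x }
  let s : OvLState R n := { s with a21 := s.a22 * s.a11 }
  let s : OvLState R n := { s with c21 := s.c21 - s.a21 }
  s

/-- Correctness of the schedule OvL (Table 4) for `C ← A·B`: it computes the
product using one temporary block, and it never writes into `A12`, `A22`, nor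
into any block of `B`, which therefore retain their initial values. -/
theorem ovl_correct {R : Type*} [CommRing R] {n : ℕ} (hn : 1 ≤ n)
    (s₀ : OvLState R n) :
    (fromBlocks (ovlRun s₀).c11 (ovlRun s₀).c12 (ovlRun s₀).c21 (ovlRun s₀).c22 =
        fromBlocks s₀.a11 s₀.a12 s₀.a21 s₀.a22 *
          fromBlocks s₀.b11 s₀.b12 s₀.b21 s₀.b22) ∧
      (ovlRun s₀).a12 = s₀.a12 ∧ (ovlRun s₀).a22 = s₀.a22 ∧
      (ovlRun s₀).b11 = s₀.b11 ∧ (ovlRun s₀).b12 = s₀.b12 ∧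
      (ovlRun s₀).b21 = s₀.b21 ∧ (ovlRun s₀).b22 = s₀.b22 := by
  refine ⟨?_, rfl, rfl, rfl, rfl, rfl, rfl⟩
  rw [fromBlocks_multiply]
  congr 1 <;> dsimp only [ovlRun] <;> noncomm_ring
end

section
/- Let R be a commutative ring, n ≥ 1, and let A = [A11, A12; A21, A22] and B = [B11, B12; B21, B22] be 2n×2n matrices over R partitioned into n×n blocks, with A⁰, B⁰ their initial values. Execute in order the assignments (each using the current contents of its operands): C22 ← A11 − A21; C21 ← A21 + A22; C12 ← B12 − B11; C11 ← A11·B11; B11 ← C21 − A11; B12 ← B22 − B12; X ← C22·B12; B12 ← B22 − C12; C22 ← C21·C12; C12 ← B12 − B21; C21 ← B11·B12; B12 ← A22·C12; B11 ← A12 − B11; C21 ← C11 + C21; C12 ← C21 + C22; C21 ← C21 + X; C22 ← C21 + C22; C21 ← C21 − B12; B12 ← B11·B22; C12 ← C12 + B12; B12 ← A12·B21; C11 ← C11 + B12. Then: (i) the final 2n×2n matrix [C11, C12; C21, C22] equals A⁰·B⁰; and (ii) the program never writes into any block of A or into B21, B22, so A and the blocks B21, B22 retain their initial values. -/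
open Matrix

/-- The memory state of the schedule OvR: the blocks of `A`, `B`, `C` and
one temporary block `X`, all of dimension `n × n`. -/
structure OvRState (R : Type*) (n : ℕ) where
  a11 : Matrix (Fin n) (Fin n) R
  a12 : Matrix (Fin n) (Fin n) R
  a21 : Matrix (Fin n) (Fin n) R
  a22 : Matrix (Fin n) (Fin n) R
  b11 : Matrix (Fin n) (Fin n) R
  b12 : Matrix (Fin n) (Fin n) R
  b21 : Matrix (Fin n) (Fin n) R
  b22 : Matrix (Fin n) (Fin n) R
  c11 : Matrix (Fin n) (Fin n) R
  c12 : Matrix (Fin n) (Fin n) R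
  c21 : Matrix (Fin n) (Fin n) R
  c22 : Matrix (Fin n) (Fin n) R
  x : Matrix (Fin n) (Fin n) R

/-- The straight-line schedule OvR (Table 5) for `C ← A·B`, executed as a
sequence of in-place assignments, each computed from the current (possibly
overwritten) contents of its operand locations. -/
def ovrRun {R : Type*} [CommRing R] {n : ℕ} (s : OvRState R n) : OvRState R n :=
  let s : OvRState R n := { s with c22 := s.a11 - s.a21 }
  let s : OvRState R n := { s with c21 := s.a21 + s.a22 }
  let s : OvRState R n := { s with c12 := s.b12 - s.b11 }
  let s : OvRState R n := { s with c11 := s.a11 * s.b11 }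
  let s : OvRState R n := { s with b11 := s.c21 - s.a11 }
  let s : OvRState R n := { s with b12 := s.b22 - s.b12 }
  let s : OvRState R n := { s with x := s.c22 * s.b12 }
  let s : OvRState R n := { s with b12 := s.b22 - s.c12 }
  let s : OvRState R n := { s with c22 := s.c21 * s.c12 }
  let s : OvRState R n := { s with c12 := s.b12 - s.b21 }
  let s : OvRState R n := { s with c21 := s.b11 * s.b12 }
  let s : OvRState R n := { s with b12 := s.a22 * s.c12 }
  let s : OvRState R n := { s with b11 := s.a12 - s.b11 }
  let s : OvRState R n := { s with c21 := s.c11 + s.c21 }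
  let s : OvRState R n := { s with c12 := s.c21 + s.c22 }
  let s : OvRState R n := { s with c21 := s.c21 + s.x }
  let s : OvRState R n := { s with c22 := s.c21 + s.c22 }
  let s : OvRState R n := { s with c21 := s.c21 - s.b12 }
  let s : OvRState R n := { s with b12 := s.b11 * s.b22 }
  let s : OvRState R n := { s with c12 := s.c12 + s.b12 }
  let s : OvRState R n := { s with b12 := s.a12 * s.b21 }
  let s : OvRState R n := { s with c11 := s.c11 + s.b12 }
  s

/-- Correctness of the schedule OvR (Table 5) for `C ← A·B`: it computes the
product using one temporary block, and it never writes into any block of `A`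
nor into `B21`, `B22`, which therefore retain their initial values. -/
theorem ovr_correct {R : Type*} [CommRing R] {n : ℕ} (hn : 1 ≤ n)
    (s₀ : OvRState R n) :
    (fromBlocks (ovrRun s₀).c11 (ovrRun s₀).c12 (ovrRun s₀).c21 (ovrRun s₀).c22 =
        fromBlocks s₀.a11 s₀.a12 s₀.a21 s₀.a22 *
          fromBlocks s₀.b11 s₀.b12 s₀.b21 s₀.b22) ∧
      (ovrRun s₀).a11 = s₀.a11 ∧ (ovrRun s₀).a12 = s₀.a12 ∧
      (ovrRun s₀).a21 = s₀.a21 ∧ (ovrRun s₀).a22 = s₀.a22 ∧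
      (ovrRun s₀).b21 = s₀.b21 ∧ (ovrRun s₀).b22 = s₀.b22 := by
  refine ⟨?_, rfl, rfl, rfl, rfl, rfl, rfl⟩
  rw [fromBlocks_multiply]
  simp only [ovrRun]
  congr 1 <;> noncomm_ring
end

section
/- Let R be a commutative ring, n ≥ 1, α, β ∈ R, and let A = [A11, A12; A21, A22], B = [B11, B12; B21, B22], C = [C11, C12; C21, C22] be 2n×2n matrices over R partitioned into n×n blocks, with A⁰, B⁰, C⁰ their initial values. Execute in order the assignments (each using the current contents of its operands): C22 ← C22 − C12; X ← A21 + A22; Y ← B12 − B11; C21 ← C21 − C22; B12 ← B22 − B12; A21 ← A11 − A21; C22 ← α·A21·B12 + β·C22; A21 ← X − A11; B12 ← B22 − Y; C12 ← α·X·Y + β·C12; Y ← α·A11·B11; X ← B12 − B21; C21 ← α·A22·X − β·C21; A22 ← A12 − A21; X ← α·A21·B12; C11 ← α·A12·B21 + β·C11; C11 ← Y + C11; X ← Y + X; C22 ← X + C22; X ← X + C12; C21 ← C22 − C21; C22 ← C22 + C12; C12 ← α·A22·B22; C12 ← X + C12. Then the final 2n×2n matrix [C11, C12; C21, C22] equals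 α·A⁰·B⁰ + β·C⁰. -/
open Matrix

/-- Correctness of the schedule AcLR (Table 6) for `C ← α·A·B + β·C`, which
uses two temporary blocks `X`, `Y`, two pre-additions on `C`, and overwrites
the input blocks `A21`, `A22` and `B12`.  Each `let` re-binding models an
assignment overwriting a memory location, computed from the current contents
of its operand locations. -/
theorem aclr_correct {R : Type*} [CommRing R] {n : ℕ} (hn : 1 ≤ n) (α β : R)
    (A11 A12 A21 A22 B11 B12 B21 B22 C11 C12 C21 C22 : Matrix (Fin n) (Fin n) R) :
    let a21 := A21
    let a22 := A22
    let b12 := B12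
    let c11 := C11
    let c12 := C12
    let c21 := C21
    let c22 := C22
    let c22 := c22 - c12
    let X := a21 + a22
    let Y := b12 - B11
    let c21 := c21 - c22
    let b12 := B22 - b12
    let a21 := A11 - a21
    let c22 := α • (a21 * b12) + β • c22
    let a21 := X - A11
    let b12 := B22 - Y
    let c12 := α • (X * Y) + β • c12
    let Y := α • (A11 * B11)
    let X := b12 - B21
    let c21 := α • (a22 * X) - β • c21
    let a22 := A12 - a21
    let X := α • (a21 * b12)
    let c11 := α • (A12 * B21) + β • c11
    let c11 := Y + c11
    let X := Y + X
    let c22 := X + c22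
    let X := X + c12
    let c21 := c22 - c21
    let c22 := c22 + c12
    let c12 := α • (a22 * B22)
    let c12 := X + c12
    fromBlocks c11 c12 c21 c22 =
      α • (fromBlocks A11 A12 A21 A22 * fromBlocks B11 B12 B21 B22) +
        β • fromBlocks C11 C12 C21 C22 := by
  extract_lets
  simp only [fromBlocks_multiply, fromBlocks_smul, fromBlocks_add, fromBlocks_inj]
  refine ⟨?_, ?_, ?_, ?_⟩ <;> simp +zetaDelta only [add_mul, mul_sub, sub_mul] <;> module
end

section
/- Let R be a commutative ring, n ≥ 1, α, β ∈ R, and let A = [A11, A12; A21, A22], B = [B11, B12; B21, B22], C = [C11, C12; C21, C22] be 2n×2n matrices over R partitioned into n×n blocks, with A⁰, B⁰, C⁰ their initial values. Execute in order the assignments (each using the current contents of its operands): C22 ← C22 − C12; X ← B12 − B11; C21 ← C21 − C22; B12 ← B22 − B12; Y ← A11 − A21; C22 ← α·Y·B12 + β·C22; Y ← A21 + A22; B12 ← B22 − X; C12 ← α·Y·X + β·C12; X ← B12 − B21; C21 ← α·A22·X − β·C21; X ← α·A11·B11; C11 ← α·A12·B21 + β·C11; Y ← Y − A11; B21 ←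 α·Y·B12; Y ← A12 − Y; B21 ← X + B21; C22 ← B21 + C22; B21 ← B21 + C12; C21 ← C22 − C21; C11 ← X + C11; C22 ← C22 + C12; C12 ← α·Y·B22; C12 ← B21 + C12. Then: (i) the final 2n×2n matrix [C11, C12; C21, C22] equals α·A⁰·B⁰ + β·C⁰; and (ii) the program never writes into any block of A, so A retains its initial value. -/
open Matrix

/-- The memory state of the schedule AccR: the blocks of `A`, `B`, `C` and
two temporary blocks `X`, `Y`, all of dimension `n × n`. -/
structure AccRState (R : Type*) (n : ℕ) where
  a11 : Matrix (Fin n) (Fin n) R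
  a12 : Matrix (Fin n) (Fin n) R
  a21 : Matrix (Fin n) (Fin n) R
  a22 : Matrix (Fin n) (Fin n) R
  b11 : Matrix (Fin n) (Fin n) R
  b12 : Matrix (Fin n) (Fin n) R
  b21 : Matrix (Fin n) (Fin n) R
  b22 : Matrix (Fin n) (Fin n) R
  c11 : Matrix (Fin n) (Fin n) R
  c12 : Matrix (Fin n) (Fin n) R
  c21 : Matrix (Fin n) (Fin n) R
  c22 : Matrix (Fin n) (Fin n) R
  x : Matrix (Fin n) (Fin n) R
  y : Matrix (Fin n) (Fin n) R

/-- The straight-line schedule AccR (Table 7) for `C ← α·A·B + β·C`, executed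
as a sequence of in-place assignments, each computed from the current
(possibly overwritten) contents of its operand locations. -/
def accrRun {R : Type*} [CommRing R] {n : ℕ} (α β : R) (s : AccRState R n) :
    AccRState R n :=
  let s : AccRState R n := { s with c22 := s.c22 - s.c12 }
  let s : AccRState R n := { s with x := s.b12 - s.b11 }
  let s : AccRState R n := { s with c21 := s.c21 - s.c22 }
  let s : AccRState R n := { s with b12 := s.b22 - s.b12 }
  let s : AccRState R n := { s with y := s.a11 - s.a21 }
  let s : AccRState R n := { s with c22 := α • (s.y * s.b12) + β • s.c22 }
  let s : AccRState R n := { s with y := s.a21 + s.a22 }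
  let s : AccRState R n := { s with b12 := s.b22 - s.x }
  let s : AccRState R n := { s with c12 := α • (s.y * s.x) + β • s.c12 }
  let s : AccRState R n := { s with x := s.b12 - s.b21 }
  let s : AccRState R n := { s with c21 := α • (s.a22 * s.x) - β • s.c21 }
  let s : AccRState R n := { s with x := α • (s.a11 * s.b11) }
  let s : AccRState R n := { s with c11 := α • (s.a12 * s.b21) + β • s.c11 }
  let s : AccRState R n := { s with y := s.y - s.a11 }
  let s : AccRState R n := { s with b21 := α • (s.y * s.b12) }
  let s : AccRState R n := { s with y := s.a12 - s.y }
  let s : AccRState R n := { s with b21 := s.x + s.b21 }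
  let s : AccRState R n := { s with c22 := s.b21 + s.c22 }
  let s : AccRState R n := { s with b21 := s.b21 + s.c12 }
  let s : AccRState R n := { s with c21 := s.c22 - s.c21 }
  let s : AccRState R n := { s with c11 := s.x + s.c11 }
  let s : AccRState R n := { s with c22 := s.c22 + s.c12 }
  let s : AccRState R n := { s with c12 := α • (s.y * s.b22) }
  let s : AccRState R n := { s with c12 := s.b21 + s.c12 }
  s

/-- Correctness of the schedule AccR (Table 7) for `C ← α·A·B + β·C`: it
computes the result using two temporary blocks, overwriting only the blocks
`B12` and `B21` of `B`, and it never writes into any block of `A`, which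
therefore retains its initial value. -/
theorem accr_correct {R : Type*} [CommRing R] {n : ℕ} (hn : 1 ≤ n) (α β : R)
    (s₀ : AccRState R n) :
    (fromBlocks (accrRun α β s₀).c11 (accrRun α β s₀).c12
        (accrRun α β s₀).c21 (accrRun α β s₀).c22 =
      α • (fromBlocks s₀.a11 s₀.a12 s₀.a21 s₀.a22 *
            fromBlocks s₀.b11 s₀.b12 s₀.b21 s₀.b22) +
        β • fromBlocks s₀.c11 s₀.c12 s₀.c21 s₀.c22) ∧
      (accrRun α β s₀).a11 = s₀.a11 ∧ (accrRun α β s₀).a12 = s₀.a12 ∧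
      (accrRun α β s₀).a21 = s₀.a21 ∧ (accrRun α β s₀).a22 = s₀.a22 := by
  refine ⟨?_, rfl, rfl, rfl, rfl⟩
  rw [fromBlocks_multiply, fromBlocks_smul, fromBlocks_smul, fromBlocks_add, fromBlocks_inj]
  refine ⟨?_, ?_, ?_, ?_⟩ <;>
  · simp only [accrRun, add_mul, mul_sub, sub_mul, smul_add, smul_sub]
    abel
end

section
/- Let R be a commutative ring, n ≥ 1, α, β ∈ R, and let A = [A11, A12; A21, A22], B = [B11, B12; B21, B22], C = [C11, C12; C21, C22] be 2n×2n matrices over R partitioned into n×n blocks, with C⁰ the initial value of C. Execute in order the assignments (each using the current contents of its operands, and never writing into any block of A or B): C22 ← C22 − C12; C12 ← C12 − C21; X ← A21 + A22; Y ← B12 − B11; C12 ← α·X·Y + β·C12; X ← X − A11; Y ← B22 − Y; C21 ← α·X·Y + β·C21; X ← A12 − X; C22 ← C12 + β·C22; C12 ← α·X·B22 + C12; X ← α·A11·B11; C21 ← C21 + X; C11 ← α·A12·B21 + β·C11; C11 ← X + C11; C12 ← C21 + C12; X ← A11 − A21; Y ← B22 − B12; C21 ← α·X·Y + C21; C22 ←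 C21 + C22; Y ← B12 − B11; Y ← B22 − Y; Y ← Y − B21; C21 ← C21 − α·A22·Y. Then the final 2n×2n matrix [C11, C12; C21, C22] equals α·A·B + β·C⁰, and A and B are never modified. -/
open Matrix

/-- The memory state of the hybrid schedule Acc: the blocks of `A`, `B`, `C`
and two temporary blocks `X`, `Y`, all of dimension `n × n`. -/
structure AccState (R : Type*) (n : ℕ) where
  a11 : Matrix (Fin n) (Fin n) R
  a12 : Matrix (Fin n) (Fin n) R
  a21 : Matrix (Fin n) (Fin n) R
  a22 : Matrix (Fin n) (Fin n) R
  b11 : Matrix (Fin n) (Fin n) R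
  b12 : Matrix (Fin n) (Fin n) R
  b21 : Matrix (Fin n) (Fin n) R
  b22 : Matrix (Fin n) (Fin n) R
  c11 : Matrix (Fin n) (Fin n) R
  c12 : Matrix (Fin n) (Fin n) R
  c21 : Matrix (Fin n) (Fin n) R
  c22 : Matrix (Fin n) (Fin n) R
  x : Matrix (Fin n) (Fin n) R
  y : Matrix (Fin n) (Fin n) R

/-- The straight-line hybrid schedule Acc (Table 8) for `C ← α·A·B + β·C`
with constant inputs `A` and `B`, executed as a sequence of in-place
assignments, each computed from the current (possibly overwritten) contents
of its operand locations; it never writes into any block of `A` or `B`. -/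
def accRun {R : Type*} [CommRing R] {n : ℕ} (α β : R) (s : AccState R n) :
    AccState R n :=
  let s : AccState R n := { s with c22 := s.c22 - s.c12 }
  let s : AccState R n := { s with c12 := s.c12 - s.c21 }
  let s : AccState R n := { s with x := s.a21 + s.a22 }
  let s : AccState R n := { s with y := s.b12 - s.b11 }
  let s : AccState R n := { s with c12 := α • (s.x * s.y) + β • s.c12 }
  let s : AccState R n := { s with x := s.x - s.a11 }
  let s : AccState R n := { s with y := s.b22 - s.y }
  let s : AccState R n := { s with c21 := α • (s.x * s.y) + β • s.c21 }
  let s : AccState R n := { s with x := s.a12 - s.x }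
  let s : AccState R n := { s with c22 := s.c12 + β • s.c22 }
  let s : AccState R n := { s with c12 := α • (s.x * s.b22) + s.c12 }
  let s : AccState R n := { s with x := α • (s.a11 * s.b11) }
  let s : AccState R n := { s with c21 := s.c21 + s.x }
  let s : AccState R n := { s with c11 := α • (s.a12 * s.b21) + β • s.c11 }
  let s : AccState R n := { s with c11 := s.x + s.c11 }
  let s : AccState R n := { s with c12 := s.c21 + s.c12 }
  let s : AccState R n := { s with x := s.a11 - s.a21 }
  let s : AccState R n := { s with y := s.b22 - s.b12 }
  let s : AccState R n := { s with c21 := α • (s.x * s.y) + s.c21 }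
  let s : AccState R n := { s with c22 := s.c21 + s.c22 }
  let s : AccState R n := { s with y := s.b12 - s.b11 }
  let s : AccState R n := { s with y := s.b22 - s.y }
  let s : AccState R n := { s with y := s.y - s.b21 }
  let s : AccState R n := { s with c21 := s.c21 - α • (s.a22 * s.y) }
  s

/-- Correctness of the hybrid schedule Acc (Table 8) for `C ← α·A·B + β·C`
with read-only inputs: it computes the result using only two temporary
blocks, and `A` and `B` are never modified. -/
theorem acc_correct {R : Type*} [CommRing R] {n : ℕ} (hn : 1 ≤ n) (α β : R)
    (s₀ : AccState R n) :
    (fromBlocks (accRun α β s₀).c11 (accRun α β s₀).c12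
        (accRun α β s₀).c21 (accRun α β s₀).c22 =
      α • (fromBlocks s₀.a11 s₀.a12 s₀.a21 s₀.a22 *
            fromBlocks s₀.b11 s₀.b12 s₀.b21 s₀.b22) +
        β • fromBlocks s₀.c11 s₀.c12 s₀.c21 s₀.c22) ∧
      (accRun α β s₀).a11 = s₀.a11 ∧ (accRun α β s₀).a12 = s₀.a12 ∧
      (accRun α β s₀).a21 = s₀.a21 ∧ (accRun α β s₀).a22 = s₀.a22 ∧
      (accRun α β s₀).b11 = s₀.b11 ∧ (accRun α β s₀).b12 = s₀.b12 ∧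
      (accRun α β s₀).b21 = s₀.b21 ∧ (accRun α β s₀).b22 = s₀.b22 := by
  refine ⟨?_, rfl, rfl, rfl, rfl, rfl, rfl, rfl, rfl⟩
  rw [fromBlocks_multiply, fromBlocks_smul, fromBlocks_smul, fromBlocks_add, fromBlocks_inj]
  refine ⟨?_, ?_, ?_, ?_⟩ <;>
    simp only [accRun, add_mul, mul_sub, sub_mul] <;>
    module
end

section
/- Define w : ℕ → ℤ by w(0) = 1, w(t+1) = 7·w(t) + 15·4^t, and v : ℕ → ℤ by v(0) = 2 and v(t+1) = 5·v(t) + 2·w(t) + 14·4^t. Then for all t, v(t) = 6·7^t − 4·4^t. -/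
/-- Closed form for the arithmetic cost of the Huss-Lederman et al.
accumulation schedule on square matrices of dimension `2^t`:
`W_acc(2^t) = 6·7^t − 4·4^t`. -/
theorem winograd_accumulation_cost_closed_form
    (w : ℕ → ℤ) (hw0 : w 0 = 1)
    (hw : ∀ t : ℕ, w (t + 1) = 7 * w t + 15 * 4 ^ t)
    (v : ℕ → ℤ) (hv0 : v 0 = 2)
    (hv : ∀ t : ℕ, v (t + 1) = 5 * v t + 2 * w t + 14 * 4 ^ t) :
    ∀ t : ℕ, v t = 6 * 7 ^ t - 4 * 4 ^ t := by
  have w_closed : ∀ t : ℕ, w t = 6 * 7 ^ t - 5 * 4 ^ t := by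
    intro t
    induction t with
    | zero => norm_num [hw0]
    | succ t ih => rw [hw, ih]; ring
  intro t
  induction t with
  | zero => norm_num [hv0]
  | succ t ih => rw [hv, ih, w_closed]; ring
end

section
/- Define w : ℕ → ℤ by w(0) = 1, w(t+1) = 7·w(t) + 15·4^t, v : ℕ → ℤ by v(0) = 2, v(t+1) = 5·v(t) + 2·w(t) + 14·4^t, and for a fixed integer k ≥ 1 define g : ℕ → ℚ by g(0) = 2k − 1 and g(t+1) = 3·w(t) + 3·(k/2^t − 1)·v(t) + g(t). Then for all t, g(t) = (36/5)·k·(7/2)^t − 12·k·2^t − 4^t + (34/5)·k. -/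
/-- Closed form for the arithmetic cost of the in-place algorithm IPMM for
`A` of dimension `n × k`, `B` of dimension `k × n` with `n = 2^t`:
`G(2^t, k) = (36/5)·k·(7/2)^t − 12·k·2^t − 4^t + (34/5)·k`. -/
theorem ipmm_rectangular_cost_closed_form
    (w : ℕ → ℤ) (hw0 : w 0 = 1)
    (hw : ∀ t : ℕ, w (t + 1) = 7 * w t + 15 * 4 ^ t)
    (v : ℕ → ℤ) (hv0 : v 0 = 2)
    (hv : ∀ t : ℕ, v (t + 1) = 5 * v t + 2 * w t + 14 * 4 ^ t)
    (k : ℤ) (hk : 1 ≤ k)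
    (g : ℕ → ℚ) (hg0 : g 0 = 2 * (k : ℚ) - 1)
    (hg : ∀ t : ℕ, g (t + 1) =
      3 * (w t : ℚ) + 3 * ((k : ℚ) / 2 ^ t - 1) * (v t : ℚ) + g t) :
    ∀ t : ℕ, g t =
      (36 / 5) * (k : ℚ) * (7 / 2) ^ t - 12 * (k : ℚ) * 2 ^ t - 4 ^ t
        + (34 / 5) * (k : ℚ) := by
  have w_eq : ∀ t, w t = 6 * 7 ^ t - 5 * 4 ^ t := by
    intro t
    induction t with
    | zero => simp [hw0]
    | succ t ih => rw [hw, ih]; ring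
  have v_eq : ∀ t, v t = 6 * 7 ^ t - 4 * 4 ^ t := by
    intro t
    induction t with
    | zero => simp [hv0]
    | succ t ih => rw [hv, ih, w_eq]; ring
  intro t
  induction t with
  | zero => rw [hg0]; ring
  | succ t ih =>
    have four_pow : (4 : ℚ) ^ t = 2 ^ t * 2 ^ t := by rw [← mul_pow]; norm_num
    rw [hg, ih, w_eq, v_eq]
    push_cast
    simp only [pow_succ, div_pow, four_pow]
    field_simp
    ring
end

section
/- Define w : ℕ → ℤ by w(0) = 1, w(t+1) = 7·w(t) + 15·4^t, and v : ℕ → ℤ by v(0) = 2, v(t+1) = 5·v(t) + 2·w(t) + 14·4^t. For k, let g_k : ℕ → ℚ be given by the rectangular recurrence g_k(0) = 2k−1, g_k(t+1) = 3·w(t) + 3·(k/2^t − 1)·v(t) + g_k(t), and for the square case k = n = 2^t let G(t) = g_{2^t}(t). Then G(t) = g_{2^t}(t) = (36/5)·7^t − 13·4^t + (34/5)·2^t. -/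
/-- Closed form of the cost `w t` of multiplying two matrices of dimension `2 ^ t`. -/
theorem strassen_cost_closed_form {w : ℕ → ℤ} (hw0 : w 0 = 1)
    (hw : ∀ t : ℕ, w (t + 1) = 7 * w t + 15 * 4 ^ t) (t : ℕ) :
    w t = 6 * 7 ^ t - 5 * 4 ^ t := by
  induction t with
  | zero => simp [hw0]
  | succ t ih => rw [hw, ih]; ring

/-- Closed form of the cost `v t` of multiplication with accumulation in dimension `2 ^ t`. -/
theorem strassen_acc_cost_closed_form {w v : ℕ → ℤ} (hv0 : v 0 = 2)
    (hw : ∀ t : ℕ, w t = 6 * 7 ^ t - 5 * 4 ^ t)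
    (hv : ∀ t : ℕ, v (t + 1) = 5 * v t + 2 * w t + 14 * 4 ^ t) (t : ℕ) :
    v t = 6 * 7 ^ t - 4 * 4 ^ t := by
  induction t with
  | zero => simp [hv0]
  | succ t ih => rw [hv, ih, hw]; ring

/-- Closed form of the rectangular cost recurrence, for a fixed second dimension `k`. -/
theorem ipmm_rect_cost_closed_form {w v : ℕ → ℤ}
    (hw : ∀ t : ℕ, w t = 6 * 7 ^ t - 5 * 4 ^ t)
    (hv : ∀ t : ℕ, v t = 6 * 7 ^ t - 4 * 4 ^ t)
    {k : ℚ} {g : ℕ → ℚ} (hg0 : g 0 = 2 * k - 1)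
    (hg : ∀ t : ℕ, g (t + 1) =
      3 * (w t : ℚ) + 3 * (k / 2 ^ t - 1) * (v t : ℚ) + g t) (t : ℕ) :
    g t = k * ((36 / 5) * (7 / 2) ^ t - 12 * 2 ^ t + 34 / 5) - 4 ^ t := by
  induction t with
  | zero => rw [hg0]; ring
  | succ t ih =>
    have h4 : (4 : ℚ) ^ t = 2 ^ t * 2 ^ t := by rw [← mul_pow]; norm_num
    rw [hg, ih, hw, hv]
    push_cast
    rw [pow_succ 4, pow_succ 2, div_pow, div_pow, pow_succ 7, pow_succ 2, h4]
    field_simp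
    ring


/-- Theorem 1 of the paper: for square matrices of dimension `n = k = 2^t`,
the arithmetic cost of the in-place algorithm IPMM is
`G(n,n) = 7.2·n^{log₂ 7} − 13·n² + 6.8·n`, i.e. the value at `k = 2^t` of the
rectangular cost recurrence equals `(36/5)·7^t − 13·4^t + (34/5)·2^t`. -/
theorem ipmm_square_cost_closed_form
    (w : ℕ → ℤ) (hw0 : w 0 = 1)
    (hw : ∀ t : ℕ, w (t + 1) = 7 * w t + 15 * 4 ^ t)
    (v : ℕ → ℤ) (hv0 : v 0 = 2)
    (hv : ∀ t : ℕ, v (t + 1) = 5 * v t + 2 * w t + 14 * 4 ^ t)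
    (g : ℕ → ℕ → ℚ) (hg0 : ∀ k : ℕ, g k 0 = 2 * (k : ℚ) - 1)
    (hg : ∀ (k : ℕ) (t : ℕ), g k (t + 1) =
      3 * (w t : ℚ) + 3 * ((k : ℚ) / 2 ^ t - 1) * (v t : ℚ) + g k t) :
    ∀ t : ℕ, g (2 ^ t) t =
      (36 / 5) * 7 ^ t - 13 * 4 ^ t + (34 / 5) * 2 ^ t := by
  have hw' := strassen_cost_closed_form hw0 hw
  have hv' := strassen_acc_cost_closed_form hv0 hw' hv
  intro t
  rw [ipmm_rect_cost_closed_form hw' hv' (hg0 _) (hg _) t]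
  have h4 : (4 : ℚ) ^ t = 2 ^ t * 2 ^ t := by rw [← mul_pow]; norm_num
  push_cast
  rw [div_pow, h4]
  field_simp
  ring
end

section
/- Define a : ℕ → ℤ by a(0) = 0, a(t+1) = 2·4^t + 7·a(t), and c : ℕ → ℚ by c(0) = 0 and c(t+1) = 3·4^t + 5·c(t) + 2·a(t). Then for all t, c(t) = (2/3)·7^t + 5^t − (5/3)·4^t. -/
/-- Total number of extra memory allocations of the Huss-Lederman et al.
accumulation schedule (Table 2) on square matrices of dimension `2^t`:
`A(2^t) = (2/3)·7^t + 5^t − (5/3)·4^t`. -/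
theorem huss_lederman_allocations_closed_form
    (a : ℕ → ℤ) (ha0 : a 0 = 0)
    (ha : ∀ t : ℕ, a (t + 1) = 2 * 4 ^ t + 7 * a t)
    (c : ℕ → ℚ) (hc0 : c 0 = 0)
    (hc : ∀ t : ℕ, c (t + 1) = 3 * 4 ^ t + 5 * c t + 2 * (a t : ℚ)) :
    ∀ t : ℕ, c t = (2 / 3) * 7 ^ t + 5 ^ t - (5 / 3) * 4 ^ t := by
  have a_closed : ∀ t : ℕ, (a t : ℚ) = (2 / 3) * (7 ^ t - 4 ^ t) := by
    intro t
    induction t with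
    | zero => simp [ha0]
    | succ t ih =>
      rw [ha]
      push_cast
      rw [ih]
      ring
  intro t
  induction t with
  | zero => norm_num [hc0]
  | succ t ih =>
    rw [hc, ih, a_closed]
    ring
end

section
/- Define w : ℕ → ℤ by w(0) = 1, w(t+1) = 7·w(t) + 15·4^t, and u : ℕ → ℚ by u(0) = 2 and u(t+1) = 4·u(t) + 3·w(t) + 17·4^t. Then for all t, u(t) = 6·7^t − 4·4^t + (t/2)·4^t. -/
/-- Arithmetic cost of the schedule AcLR (Table 6) for `C ← α·A·B + β·C`
overwriting both inputs, on square matrices of dimension `2^t`: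
`W(2^t) = 6·7^t − 4·4^t + (t/2)·4^t`. -/
theorem aclr_cost_closed_form
    (w : ℕ → ℤ) (hw0 : w 0 = 1)
    (hw : ∀ t : ℕ, w (t + 1) = 7 * w t + 15 * 4 ^ t)
    (u : ℕ → ℚ) (hu0 : u 0 = 2)
    (hu : ∀ t : ℕ, u (t + 1) = 4 * u t + 3 * (w t : ℚ) + 17 * 4 ^ t) :
    ∀ t : ℕ, u t = 6 * 7 ^ t - 4 * 4 ^ t + ((t : ℚ) / 2) * 4 ^ t := by
  have hw_closed : ∀ t : ℕ, w t = 6 * 7 ^ t - 5 * 4 ^ t := by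
    intro t
    induction t with
    | zero => simp [hw0]
    | succ t ih => rw [hw, ih]; ring
  intro t
  induction t with
  | zero => rw [hu0]; norm_num
  | succ t ih => rw [hu, ih, hw_closed]; push_cast; ring
end
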